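/- Let the signal be S(θ,t) = a|t−θ|^κ + h(θ,t) with a ≠ 0, κ ∈ (0,1/2), H = κ + 1/2, where h is continuous on ℝ × [0,T], continuously differentiable in θ, and |∂_θ h(θ,t)| ≤ L for all θ, t. Let Φ(θ,θ₀) = ∫₀ᵀ (S(θ,t) − S(θ₀,t))² dt and fix θ₀ ∈ (0,T). Then Φ(θ,θ₀)/|θ−θ₀|^{2H} → Γ² as θ → θ₀ with θ ≠ θ₀, where Γ² = a² ∫_ℝ (|v−1|^κ − |v|^κ)² dv. -/

import Mathlib

open MeasureTheory Filter

/-- For `0 ≤ x ≤ y` and `0 < y`, the power function of exponent `κ ≤ 1` has increments at most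
`y ^ (κ - 1) * (y - x)`. -/
lemma rpow_sub_rpow_le_rpow_mul_sub {κ x y : ℝ} (hκ : κ ≤ 1) (hx : 0 ≤ x) (hy : 0 < y)
    (hxy : x ≤ y) : y ^ κ - x ^ κ ≤ y ^ (κ - 1) * (y - x) := by
  rcases hx.eq_or_lt with rfl | hx
  · rw [sub_zero, Real.rpow_sub_one hy.ne', div_mul_cancel₀ _ hy.ne']
    linarith [Real.rpow_nonneg le_rfl κ]
  · have h1 : y ^ (κ - 1) ≤ x ^ (κ - 1) :=
      Real.rpow_le_rpow_of_nonpos hx hxy (by linarith)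
    have hxe : x ^ κ = x ^ (κ - 1) * x := by
      rw [Real.rpow_sub_one hx.ne', div_mul_cancel₀ _ hx.ne']
    have hye : y ^ κ = y ^ (κ - 1) * y := by
      rw [Real.rpow_sub_one hy.ne', div_mul_cancel₀ _ hy.ne']
    rw [hxe, hye]
    nlinarith

lemma one_third_rpow_le {κ : ℝ} (hκ0 : 0 < κ) : (1 / 3 : ℝ) ^ (κ - 1) ≤ 3 := by
  have h : (1 / 3 : ℝ) ^ (κ - 1) ≤ (1 / 3 : ℝ) ^ (-1 : ℝ) :=
    Real.rpow_le_rpow_of_exponent_ge (by norm_num) (by norm_num) (by linarith)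
  rw [Real.rpow_neg_one] at h
  linarith

/-- The cusp increment decays like `|v| ^ (κ - 1)`. -/
lemma abs_cusp_increment_le {κ : ℝ} (hκ0 : 0 < κ) (hκ : κ ≤ 1) (v : ℝ) :
    |(|v - 1| ^ κ - |v| ^ κ)| ≤ 3 * (1 + |v|) ^ (κ - 1) := by
  have key : ∀ x y : ℝ, 0 ≤ x → x ≤ y → y - x ≤ 1 → (1 / 3) * (1 + |v|) ≤ y →
      |y ^ κ - x ^ κ| ≤ 3 * (1 + |v|) ^ (κ - 1) := by
    intro x y hx hxy h1 hy
    have hv := abs_nonneg v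
    have hy0 : 0 < y := by linarith
    rw [abs_of_nonneg (sub_nonneg.2 (Real.rpow_le_rpow hx hxy hκ0.le))]
    calc y ^ κ - x ^ κ ≤ y ^ (κ - 1) * (y - x) := rpow_sub_rpow_le_rpow_mul_sub hκ hx hy0 hxy
      _ ≤ y ^ (κ - 1) := mul_le_of_le_one_right (by positivity) h1
      _ ≤ ((1 / 3) * (1 + |v|)) ^ (κ - 1) :=
        Real.rpow_le_rpow_of_nonpos (by positivity) hy (by linarith)
      _ = (1 / 3) ^ (κ - 1) * (1 + |v|) ^ (κ - 1) :=
        Real.mul_rpow (by norm_num) (by positivity)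
      _ ≤ 3 * (1 + |v|) ^ (κ - 1) := by gcongr; exact one_third_rpow_le hκ0
  rcases le_total |v| |v - 1| with h | h
  · refine key _ _ (abs_nonneg _) h ?_ ?_
    · have := abs_sub v 1
      rw [abs_one] at this
      linarith
    · cases abs_cases v <;> cases abs_cases (v - 1) <;> linarith
  · rw [abs_sub_comm]
    refine key _ _ (abs_nonneg _) h ?_ ?_ <;>
      cases abs_cases v <;> cases abs_cases (v - 1) <;> linarith

/-- A small shift `u` keeping `u * v` bounded by `T` satisfies a bound uniform in `u`. -/
lemma abs_rpow_one_sub_le {κ T u v : ℝ} (hκ0 : 0 < κ) (hκ : κ ≤ 1) (hT : 0 ≤ T) (hu : |u| ≤ 1)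
    (huv : |u * v| ≤ T) : |u| ^ (1 - κ) ≤ (1 + T) * (1 + |v|) ^ (κ - 1) := by
  have hv : 0 < 1 + |v| := by positivity
  rw [abs_mul] at huv
  have h1 : |u| ≤ (1 + T) / (1 + |v|) := by
    rw [le_div_iff₀ hv]
    linarith
  calc |u| ^ (1 - κ) ≤ ((1 + T) / (1 + |v|)) ^ (1 - κ) :=
        Real.rpow_le_rpow (abs_nonneg _) h1 (by linarith)
    _ = (1 + T) ^ (1 - κ) * (1 + |v|) ^ (κ - 1) := by
        rw [Real.div_rpow (by linarith) hv.le, div_eq_mul_inv, ← Real.rpow_neg hv.le, neg_sub]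
    _ ≤ (1 + T) * (1 + |v|) ^ (κ - 1) := by
        gcongr
        exact Real.rpow_le_self_of_one_le (by linarith) (by linarith)

/-- Affine change of variables `t = c + u * v` in an integral over an interval. -/
lemma intervalIntegral_eq_abs_mul_integral_indicator {T c u : ℝ} (hT : 0 ≤ T) (hu : u ≠ 0)
    (F : ℝ → ℝ) :
    ∫ t in (0 : ℝ)..T, F t = |u| * ∫ v, (Set.Ioc 0 T).indicator F (c + u * v) := by
  rw [intervalIntegral.integral_of_le hT, ← integral_indicator measurableSet_Ioc,
    Measure.integral_comp_mul_left (fun x => (Set.Ioc 0 T).indicator F (c + x)) u,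
    integral_add_left_eq_self, smul_eq_mul, abs_inv, mul_inv_cancel_left₀ (abs_ne_zero.2 hu)]

/-- For the cusp signal `S(θ,t) = a|t−θ|^κ + h(θ,t)` with smooth `h`, the normalized squared
`L²(0,T)` distance `Φ(θ,θ₀)/|θ−θ₀|^{2H}` converges to `Γ² = a² ∫_ℝ (|v−1|^κ − |v|^κ)² dv`
as `θ → θ₀`, `θ ≠ θ₀`, where `H = κ + 1/2`. -/
theorem cusp_distance_asymptotics (a κ H T L θ₀ : ℝ) (h h' : ℝ → ℝ → ℝ)
    (ha : a ≠ 0) (hκ0 : 0 < κ) (hκ : κ < 1/2) (hH : H = κ + 1/2) (hT : 0 < T)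
    (hcont : ContinuousOn (fun p : ℝ × ℝ => h p.1 p.2) (Set.univ ×ˢ Set.Icc 0 T))
    (hderiv : ∀ θ t, HasDerivAt (fun θ : ℝ => h θ t) (h' θ t) θ)
    (hcont' : ContinuousOn (fun p : ℝ × ℝ => h' p.1 p.2) (Set.univ ×ˢ Set.Icc 0 T))
    (hL : ∀ θ t, |h' θ t| ≤ L)
    (hθ₀ : θ₀ ∈ Set.Ioo 0 T) :
    Tendsto
      (fun θ : ℝ =>
        (∫ t in (0:ℝ)..T,
          ((a * |t - θ| ^ κ + h θ t) - (a * |t - θ₀| ^ κ + h θ₀ t)) ^ 2) /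
          |θ - θ₀| ^ (2 * H))
      (nhdsWithin θ₀ {θ₀}ᶜ)
      (nhds (a ^ 2 * ∫ v : ℝ, (|v - 1| ^ κ - |v| ^ κ) ^ 2)) := by
  have hL0 : 0 ≤ L := (abs_nonneg _).trans (hL 0 0)
  have hlip : ∀ x y t, |h x t - h y t| ≤ L * |x - y| := fun x y t =>
    Convex.norm_image_sub_le_of_norm_hasDerivWithin_le (f := fun θ => h θ t)
      (f' := fun θ => h' θ t) (fun z _ => (hderiv z t).hasDerivWithinAt) (fun z _ => hL z t)
      convex_univ (Set.mem_univ y) (Set.mem_univ x)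
  set D : ℝ → ℝ → ℝ := fun θ t => h θ t - h θ₀ t
  set P : ℝ → ℝ → ℝ := fun θ v =>
    (Set.Ioc 0 T).indicator (fun t => ((a * |t - θ| ^ κ + h θ t) -
      (a * |t - θ₀| ^ κ + h θ₀ t)) ^ 2) (θ₀ + (θ - θ₀) * v) / |θ - θ₀| ^ (2 * κ) with hP
  have hval : ∀ θ v, θ ≠ θ₀ → θ₀ + (θ - θ₀) * v ∈ Set.Ioc 0 T →
      P θ v = (a * (|v - 1| ^ κ - |v| ^ κ) +
        D θ (θ₀ + (θ - θ₀) * v) / |θ - θ₀| ^ κ) ^ 2 := by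
    intro θ v hθ hmem
    have hu : 0 < |θ - θ₀| := abs_pos.2 (sub_ne_zero.2 hθ)
    have hp : 0 < |θ - θ₀| ^ κ := Real.rpow_pos_of_pos hu κ
    have e1 : |θ₀ + (θ - θ₀) * v - θ| ^ κ = |θ - θ₀| ^ κ * |v - 1| ^ κ := by
      rw [← Real.mul_rpow (abs_nonneg _) (abs_nonneg _), ← abs_mul]
      ring_nf
    have e2 : |θ₀ + (θ - θ₀) * v - θ₀| ^ κ = |θ - θ₀| ^ κ * |v| ^ κ := by
      rw [← Real.mul_rpow (abs_nonneg _) (abs_nonneg _), ← abs_mul]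
      ring_nf
    have e3 : |θ - θ₀| ^ (2 * κ) = (|θ - θ₀| ^ κ) ^ 2 := by
      rw [mul_comm, Real.rpow_mul_natCast (abs_nonneg _) κ 2 |>.symm]
      norm_num
    simp only [hP, Set.indicator_of_mem hmem, e1, e2, e3, D]
    field_simp
    ring
  have hrem : ∀ θ t, θ ≠ θ₀ → |D θ t / |θ - θ₀| ^ κ| ≤ L * |θ - θ₀| ^ (1 - κ) := by
    intro θ t hθ
    have hu : 0 < |θ - θ₀| := abs_pos.2 (sub_ne_zero.2 hθ)
    have hp : 0 < |θ - θ₀| ^ κ := Real.rpow_pos_of_pos hu κ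
    rw [abs_div, abs_of_pos hp, div_le_iff₀ hp, mul_assoc, ← Real.rpow_add hu,
      sub_add_cancel, Real.rpow_one]
    exact hlip θ θ₀ t
  have hne : ∀ᶠ θ in nhdsWithin θ₀ {θ₀}ᶜ, θ ≠ θ₀ := self_mem_nhdsWithin
  have htend : Tendsto (fun θ => θ - θ₀) (nhdsWithin θ₀ {θ₀}ᶜ) (nhds 0) := by
    have : Tendsto (fun θ => θ - θ₀) (nhds θ₀) (nhds (θ₀ - θ₀)) :=
      (continuous_id.sub continuous_const).tendsto θ₀
    rw [sub_self] at this
    exact this.mono_left nhdsWithin_le_nhds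
  have habs : Tendsto (fun θ => |θ - θ₀|) (nhdsWithin θ₀ {θ₀}ᶜ) (nhds 0) := by
    simpa using htend.abs
  have hmain : Tendsto (fun θ => ∫ v, P θ v) (nhdsWithin θ₀ {θ₀}ᶜ)
      (nhds (∫ v : ℝ, a ^ 2 * (|v - 1| ^ κ - |v| ^ κ) ^ 2)) := by
    refine tendsto_integral_filter_of_dominated_convergence
      (fun v => (3 * |a| + L * (1 + T)) ^ 2 * (1 + ‖v‖) ^ (-(2 - 2 * κ))) ?_ ?_ ?_ ?_
    · refine Eventually.of_forall fun θ => ?_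
      have hφ : Continuous fun v : ℝ => θ₀ + (θ - θ₀) * v := by fun_prop
      have hc : ∀ x, ContinuousOn (h x) (Set.Icc 0 T) := fun x =>
        hcont.comp (f := fun t : ℝ => (x, t)) (by fun_prop) fun t ht => ⟨Set.mem_univ _, ht⟩
      have hpow : ∀ x : ℝ, Continuous fun t : ℝ => a * |t - x| ^ κ := fun x =>
        continuous_const.mul ((continuous_id.sub continuous_const).abs.rpow_const
          fun _ => Or.inr hκ0.le)
      have hF : ContinuousOn (fun t => ((a * |t - θ| ^ κ + h θ t) -
          (a * |t - θ₀| ^ κ + h θ₀ t)) ^ 2) (Set.Ioc 0 T) :=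
        ((((hpow θ).continuousOn.add (hc θ)).sub
          ((hpow θ₀).continuousOn.add (hc θ₀))).pow 2).mono Set.Ioc_subset_Icc_self
      have hset : MeasurableSet ((fun v : ℝ => θ₀ + (θ - θ₀) * v) ⁻¹' Set.Ioc 0 T) :=
        hφ.measurable measurableSet_Ioc
      simp only [hP, div_eq_mul_inv]
      refine AEStronglyMeasurable.mul_const ?_ _
      exact (aestronglyMeasurable_indicator_iff hset).2
        ((hF.comp hφ.continuousOn fun _ hv => hv).aestronglyMeasurable hset)
    · filter_upwards [hne, habs.eventually_le_const one_pos] with θ hθ hu1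
      refine Eventually.of_forall fun v => ?_
      by_cases hmem : θ₀ + (θ - θ₀) * v ∈ Set.Ioc 0 T
      · have hw : 0 < 1 + |v| := by positivity
        have huv : |(θ - θ₀) * v| ≤ T := by
          rw [abs_le]
          constructor <;> linarith [hmem.1, hmem.2, hθ₀.1, hθ₀.2]
        have hb : |a * (|v - 1| ^ κ - |v| ^ κ) +
            D θ (θ₀ + (θ - θ₀) * v) / |θ - θ₀| ^ κ| ≤
            (3 * |a| + L * (1 + T)) * (1 + |v|) ^ (κ - 1) := by
          have b1 := mul_le_mul_of_nonneg_left
            (abs_cusp_increment_le hκ0 (by linarith) v) (abs_nonneg a)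
          have b2 := (hrem θ (θ₀ + (θ - θ₀) * v) hθ).trans (mul_le_mul_of_nonneg_left
            (abs_rpow_one_sub_le hκ0 (by linarith) hT.le hu1 huv) hL0)
          refine (abs_add_le _ _).trans ?_
          rw [abs_mul]
          linarith
        have hsq : (1 + |v|) ^ (-(2 - 2 * κ)) = ((1 + |v|) ^ (κ - 1)) ^ 2 := by
          rw [← Real.rpow_mul_natCast hw.le]
          congr 1
          push_cast
          ring
        rw [hval θ v hθ hmem, Real.norm_eq_abs, Real.norm_eq_abs, abs_pow, hsq, ← mul_pow]
        exact pow_le_pow_left₀ (abs_nonneg _) hb 2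
      · simp only [hP, Set.indicator_of_notMem hmem, zero_div, norm_zero]
        positivity
    · refine (integrable_one_add_norm ?_).const_mul _
      rw [Module.finrank_self]
      push_cast
      linarith
    · refine Eventually.of_forall fun v => ?_
      have hev : ∀ᶠ θ in nhdsWithin θ₀ {θ₀}ᶜ, θ₀ + (θ - θ₀) * v ∈ Set.Ioc 0 T := by
        have : Tendsto (fun θ => θ₀ + (θ - θ₀) * v) (nhdsWithin θ₀ {θ₀}ᶜ) (nhds θ₀) := by
          simpa using (htend.mul_const v).const_add θ₀
        exact this.eventually (Ioc_mem_nhds hθ₀.1 hθ₀.2)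
      have hr : Tendsto (fun θ => D θ (θ₀ + (θ - θ₀) * v) / |θ - θ₀| ^ κ)
          (nhdsWithin θ₀ {θ₀}ᶜ) (nhds 0) := by
        have hz : Tendsto (fun θ => L * |θ - θ₀| ^ (1 - κ)) (nhdsWithin θ₀ {θ₀}ᶜ) (nhds 0) := by
          have := (habs.rpow_const (p := 1 - κ) (Or.inr (by linarith))).const_mul L
          rwa [Real.zero_rpow (by linarith), mul_zero] at this
        refine squeeze_zero_norm' ?_ hz
        filter_upwards [hne] with θ hθ using hrem θ _ hθ
      have hlim := (hr.const_add (a * (|v - 1| ^ κ - |v| ^ κ))).pow 2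
      rw [add_zero, mul_pow] at hlim
      refine hlim.congr' ?_
      filter_upwards [hne, hev] with θ hθ hmem using (hval θ v hθ hmem).symm
  rw [← integral_const_mul]
  refine hmain.congr' ?_
  filter_upwards [hne] with θ hθ
  have hu : 0 < |θ - θ₀| := abs_pos.2 (sub_ne_zero.2 hθ)
  have hH2 : 2 * H = 1 + 2 * κ := by rw [hH]; ring
  rw [intervalIntegral_eq_abs_mul_integral_indicator (c := θ₀) hT.le (sub_ne_zero.2 hθ), hH2,
    Real.rpow_add hu, Real.rpow_one, mul_div_mul_left _ _ hu.ne', ← integral_div]
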